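/- arXiv:1901.01763 — 4 statements merged into one kernel-verified Lean document; each statement's English description precedes it below -/
import Mathlib

section
/- Let s > 0, ε > 0, and consider a trajectory γ on [0,T] with a tiling (P, (I_p)) with tile side εs/2. Suppose c* ∈ ℝ² maximizes point-weight among all squares of side s + εs/2, i.e., for every c ∈ ℝ², Σ_{p ∈ P, p ∈ Q(c*, s + εs/2)} λ(I_p) ≥ Σ_{p ∈ P, p ∈ Q(c, s + εs/2)} λ(I_p). Then the square Q(c*, (1+ε)s) is a (1+ε)-approximate hotspot: for every c ∈ ℝ², λ({t ∈ [0,T] : γ t ∈ Q(c*, (1+ε)s)}) ≥ λ({t ∈ [0,T] : γ t ∈ Q(c, s)}). -/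
open MeasureTheory
open scoped Classical

/-- The closed axis-aligned square of side length `L` centered at `c`:
`{x : ℝ × ℝ | ‖x − c‖_∞ ≤ L/2}`. -/
def Q (c : ℝ × ℝ) (L : ℝ) : Set (ℝ × ℝ) :=
  {x | |x.1 - c.1| ≤ L / 2 ∧ |x.2 - c.2| ≤ L / 2}

/-- A square centered at a point of a second square lies in the square concentric with the second
one whose side is the sum of the two sides. -/
theorem mem_Q_of_mem_of_mem {c p x : ℝ × ℝ} {a b L : ℝ} (hx : x ∈ Q p a) (hp : p ∈ Q c b)
    (hL : a + b ≤ L) : x ∈ Q c L := by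
  refine ⟨(abs_sub_le x.1 p.1 c.1).trans ?_, (abs_sub_le x.2 p.2 c.2).trans ?_⟩
  · linarith [hx.1, hp.1]
  · linarith [hx.2, hp.2]

theorem mem_Q_comm {p x : ℝ × ℝ} {a : ℝ} : x ∈ Q p a ↔ p ∈ Q x a := by
  simp only [Q, Set.mem_ofPred_eq, abs_sub_comm]

theorem approx_hotspot
    (s ε T : ℝ) (hs : 0 < s) (hε : 0 < ε) (hT : 0 < T)
    (γ : ℝ → ℝ × ℝ) (hγ : Measurable γ)
    (P : Finset (ℝ × ℝ)) (I : ℝ × ℝ → Set ℝ)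
    (hmeas : ∀ p ∈ P, MeasurableSet (I p))
    (hdisj : ∀ p ∈ P, ∀ q ∈ P, p ≠ q → Disjoint (I p) (I q))
    (hcover : (⋃ p ∈ P, I p) = Set.Icc (0 : ℝ) T)
    (htile : ∀ p ∈ P, ∀ t ∈ I p, γ t ∈ Q p (ε * s / 2))
    (cstar : ℝ × ℝ)
    (hmax : ∀ c : ℝ × ℝ,
      ∑ p ∈ P.filter (fun p => p ∈ Q cstar (s + ε * s / 2)), volume (I p) ≥
        ∑ p ∈ P.filter (fun p => p ∈ Q c (s + ε * s / 2)), volume (I p)) :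
    ∀ c : ℝ × ℝ,
      volume {t : ℝ | t ∈ Set.Icc (0 : ℝ) T ∧ γ t ∈ Q cstar ((1 + ε) * s)} ≥
        volume {t : ℝ | t ∈ Set.Icc (0 : ℝ) T ∧ γ t ∈ Q c s} := by
  intro c
  refine le_trans ?_ ((hmax c).trans ?_)
  · refine le_trans (measure_mono ?_) (measure_biUnion_finset_le _ _)
    rintro t ⟨ht, htQ⟩
    rw [← hcover] at ht
    obtain ⟨p, hp, htp⟩ := Set.mem_iUnion₂.1 ht
    refine Set.mem_iUnion₂.2 ⟨p, Finset.mem_filter.2 ⟨hp, ?_⟩, htp⟩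
    exact mem_Q_of_mem_of_mem (mem_Q_comm.1 (htile p hp t htp)) htQ (by linarith)
  · rw [← measure_biUnion_finset]
    · refine measure_mono fun t ht => ?_
      obtain ⟨p, hp, htp⟩ := Set.mem_iUnion₂.1 ht
      obtain ⟨hpP, hpQ⟩ := Finset.mem_filter.1 hp
      refine ⟨hcover ▸ Set.mem_iUnion₂.2 ⟨p, hpP, htp⟩, ?_⟩
      exact mem_Q_of_mem_of_mem (htile p hpP t htp) hpQ (by linarith)
    · intro p hp q hq hpq
      exact hdisj p (Finset.mem_filter.1 hp).1 q (Finset.mem_filter.1 hq).1 hpq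
    · exact fun p hp => hmeas p (Finset.mem_filter.1 hp).1
end

section
/- Let γ be a trajectory on [0,T], let s > 0, and let c ≥ 1/2. For every center x ∈ ℝ² there exists a center y ∈ ℝ² such that the weight of the square Q(y, c·s) is at least one quarter of the weight of Q(x, s); that is, λ({t ∈ [0,T] : γ t ∈ Q(y, c·s)}) ≥ (1/4) · λ({t ∈ [0,T] : γ t ∈ Q(x, s)}). -/
open MeasureTheory

/-- If `|u - a| ≤ s / 2` then `u` lies within `c * s / 2` of one of `a ± s / 4`, for `c ≥ 1 / 2`. -/
lemma abs_sub_quarter_le {u a s c : ℝ} (hs : 0 < s) (hc : 1 / 2 ≤ c) (h : |u - a| ≤ s / 2) :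
    |u - (a - s / 4)| ≤ c * s / 2 ∨ |u - (a + s / 4)| ≤ c * s / 2 := by
  have hcs : 1 / 2 * s ≤ c * s := mul_le_mul_of_nonneg_right hc hs.le
  rw [abs_le] at h
  rcases le_total u a with hu | hu
  · left; rw [abs_le]; constructor <;> linarith
  · right; rw [abs_le]; constructor <;> linarith

/-- A square of side `s` is covered by four squares of side `c * s`, for `c ≥ 1 / 2`. -/
lemma Q_subset_union (x : ℝ × ℝ) {s c : ℝ} (hs : 0 < s) (hc : 1 / 2 ≤ c) :
    Q x s ⊆ (Q (x.1 - s / 4, x.2 - s / 4) (c * s) ∪ Q (x.1 - s / 4, x.2 + s / 4) (c * s)) ∪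
      (Q (x.1 + s / 4, x.2 - s / 4) (c * s) ∪ Q (x.1 + s / 4, x.2 + s / 4) (c * s)) := by
  rintro u ⟨h₁, h₂⟩
  have h₁' := abs_sub_quarter_le hs hc h₁
  have h₂' := abs_sub_quarter_le hs hc h₂
  simp only [Q, Set.mem_union, Set.mem_ofPred_eq]
  tauto

theorem corner_square
    (T s c : ℝ) (hT : 0 < T) (hs : 0 < s) (hc : 1 / 2 ≤ c)
    (γ : ℝ → ℝ × ℝ) (hγ : Measurable γ) :
    ∀ x : ℝ × ℝ, ∃ y : ℝ × ℝ,
      volume {t : ℝ | t ∈ Set.Icc (0 : ℝ) T ∧ γ t ∈ Q y (c * s)} ≥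
        (1 / 4) * volume {t : ℝ | t ∈ Set.Icc (0 : ℝ) T ∧ γ t ∈ Q x s} := by
  intro x
  by_contra! h
  let V (y : ℝ × ℝ) := {t : ℝ | t ∈ Set.Icc (0 : ℝ) T ∧ γ t ∈ Q y (c * s)}
  set W := {t : ℝ | t ∈ Set.Icc (0 : ℝ) T ∧ γ t ∈ Q x s}
  have hW : W ⊆ (V (x.1 - s / 4, x.2 - s / 4) ∪ V (x.1 - s / 4, x.2 + s / 4)) ∪
      (V (x.1 + s / 4, x.2 - s / 4) ∪ V (x.1 + s / 4, x.2 + s / 4)) := by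
    rintro t ⟨ht, hx⟩
    rcases Q_subset_union x hs hc hx with (h | h) | (h | h)
    · exact Or.inl (Or.inl ⟨ht, h⟩)
    · exact Or.inl (Or.inr ⟨ht, h⟩)
    · exact Or.inr (Or.inl ⟨ht, h⟩)
    · exact Or.inr (Or.inr ⟨ht, h⟩)
  have hle := (measure_mono hW).trans <| (measure_union_le (μ := volume) _ _).trans <|
    add_le_add (measure_union_le _ _) (measure_union_le _ _)
  have hlt := hle.trans_lt (ENNReal.add_lt_add (ENNReal.add_lt_add (h _) (h _))
    (ENNReal.add_lt_add (h _) (h _)))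
  have hsum : (1 / 4 * volume W + 1 / 4 * volume W) + (1 / 4 * volume W + 1 / 4 * volume W)
      = volume W := by
    calc _ = 4 * (4 : ENNReal)⁻¹ * volume W := by rw [one_div]; ring
      _ = volume W := by rw [ENNReal.mul_inv_cancel (by norm_num) (by norm_num), one_mul]
  exact (hlt.trans_eq hsum).false
end

section
/- Let γ be a trajectory on [0,T] and let s > 0. Suppose y ∈ ℝ² is such that the weight of Q(y, s) is at least the weight of every square of side s/2, i.e., for all x ∈ ℝ², λ({t ∈ [0,T] : γ t ∈ Q(y, s)}) ≥ λ({t ∈ [0,T] : γ t ∈ Q(x, s/2)}). Then Q(y, s) is a 1/4-duration-approximate hotspot: for every x ∈ ℝ², λ({t ∈ [0,T] : γ t ∈ Q(y, s)}) ≥ (1/4) · λ({t ∈ [0,T] : γ t ∈ Q(x, s)}). -/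
open MeasureTheory

/-- The square of side `s` is covered by its four quadrants, squares of side `s / 2`. -/
theorem Q_subset_quadrants (x : ℝ × ℝ) (s : ℝ) :
    Q x s ⊆ (Q (x.1 - s / 4, x.2 - s / 4) (s / 2) ∪ Q (x.1 - s / 4, x.2 + s / 4) (s / 2)) ∪
      (Q (x.1 + s / 4, x.2 - s / 4) (s / 2) ∪ Q (x.1 + s / 4, x.2 + s / 4) (s / 2)) := by
  rintro p ⟨h₁, h₂⟩
  simp only [Q, Set.mem_union, Set.mem_ofPred_eq, abs_le] at h₁ h₂ ⊢
  rcases le_total p.1 x.1 with h | h <;> rcases le_total p.2 x.2 with h' | h'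
  · exact .inl (.inl ⟨⟨by linarith, by linarith⟩, by linarith, by linarith⟩)
  · exact .inl (.inr ⟨⟨by linarith, by linarith⟩, by linarith, by linarith⟩)
  · exact .inr (.inl ⟨⟨by linarith, by linarith⟩, by linarith, by linarith⟩)
  · exact .inr (.inr ⟨⟨by linarith, by linarith⟩, by linarith, by linarith⟩)

theorem duration_approx_hotspot
    (T s : ℝ) (hT : 0 < T) (hs : 0 < s)
    (γ : ℝ → ℝ × ℝ) (hγ : Measurable γ)
    (y : ℝ × ℝ)
    (hmax : ∀ x : ℝ × ℝ,
      volume {t : ℝ | t ∈ Set.Icc (0 : ℝ) T ∧ γ t ∈ Q y s} ≥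
        volume {t : ℝ | t ∈ Set.Icc (0 : ℝ) T ∧ γ t ∈ Q x (s / 2)}) :
    ∀ x : ℝ × ℝ,
      volume {t : ℝ | t ∈ Set.Icc (0 : ℝ) T ∧ γ t ∈ Q y s} ≥
        (1 / 4) * volume {t : ℝ | t ∈ Set.Icc (0 : ℝ) T ∧ γ t ∈ Q x s} := by
  intro x
  set M := volume {t : ℝ | t ∈ Set.Icc (0 : ℝ) T ∧ γ t ∈ Q y s}
  let A : Set (ℝ × ℝ) → Set ℝ := fun S => {t | t ∈ Set.Icc (0 : ℝ) T ∧ γ t ∈ S}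
  have hunion (S S' : Set (ℝ × ℝ)) : volume (A (S ∪ S')) ≤ volume (A S) + volume (A S') :=
    (measure_mono fun t ht => ht.2.imp (fun h => ⟨ht.1, h⟩) fun h => ⟨ht.1, h⟩).trans
      (measure_union_le _ _)
  have hle : volume (A (Q x s)) ≤ 4 * M :=
    calc volume (A (Q x s))
      _ ≤ volume (A (_ ∪ _)) := measure_mono fun t ht => ⟨ht.1, Q_subset_quadrants x s ht.2⟩
      _ ≤ (M + M) + (M + M) := (hunion _ _).trans (add_le_add
          ((hunion _ _).trans (add_le_add (hmax _) (hmax _)))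
          ((hunion _ _).trans (add_le_add (hmax _) (hmax _))))
      _ = 4 * M := by ring
  calc (1 / 4) * volume (A (Q x s))
    _ ≤ (1 / 4) * (4 * M) := by gcongr
    _ = M := by
      rw [← mul_assoc, one_div, ENNReal.inv_mul_cancel (by norm_num) (by norm_num), one_mul]
end

section
/- Let P be a nonempty finite set of points in ℝ², let w' : P → ℝ≥0 be a weight function, and let L > 0. Then there exists a center c ∈ ℝ² such that the closed axis-aligned square Q(c, L) has maximum point-weight among all closed axis-aligned squares of side L (i.e., for all c' ∈ ℝ², Σ_{p ∈ P ∩ Q(c, L)} w'(p) ≥ Σ_{p ∈ P ∩ Q(c', L)} w'(p)), and moreover Q(c, L) has a point of P on its bottom side and a point of P on its left side (i.e., there exist p, q ∈ P with p ∈ Q(c, L), p.2 = c.2 − L/2, q ∈ Q(c, L), and q.1 = c.1 − L/2). -/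
open scoped Classical NNReal

/-- A square of side `L` meeting `P` can be translated so that it keeps all its points of `P` and
has a point of `P` on its bottom side and a point of `P` on its left side. -/
theorem exists_center_subset_of_nonempty (P : Finset (ℝ × ℝ)) (L : ℝ) (c' : ℝ × ℝ)
    (h : (P.filter (fun p => p ∈ Q c' L)).Nonempty) :
    ∃ c : ℝ × ℝ,
      P.filter (fun p => p ∈ Q c' L) ⊆ P.filter (fun p => p ∈ Q c L) ∧
      (∃ p ∈ P, p ∈ Q c L ∧ p.2 = c.2 - L / 2) ∧
      (∃ q ∈ P, q ∈ Q c L ∧ q.1 = c.1 - L / 2) := by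
  obtain ⟨p, hp, hpmin⟩ := Finset.exists_min_image _ (fun x : ℝ × ℝ => x.2) h
  obtain ⟨q, hq, hqmin⟩ := Finset.exists_min_image _ (fun x : ℝ × ℝ => x.1) h
  have hsub : P.filter (fun x => x ∈ Q c' L) ⊆
      P.filter (fun x => x ∈ Q (q.1 + L / 2, p.2 + L / 2) L) := by
    intro x hx
    have h1 := hqmin x hx
    have h2 := hpmin x hx
    simp only [Finset.mem_filter, Q, Set.mem_ofPred_eq, abs_le] at hx hp hq ⊢
    refine ⟨hx.1, ⟨?_, ?_⟩, ?_, ?_⟩ <;> linarith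
  refine ⟨_, hsub, ⟨p, ?_⟩, ⟨q, ?_⟩⟩
  · have hpc := Finset.mem_filter.mp (hsub hp)
    exact ⟨hpc.1, hpc.2, by simp⟩
  · have hqc := Finset.mem_filter.mp (hsub hq)
    exact ⟨hqc.1, hqc.2, by simp⟩

/-- The point-weight of squares of side `L` attains its maximum, at a square meeting `P`. -/
theorem exists_center_max_weight (P : Finset (ℝ × ℝ)) (hP : P.Nonempty) (w' : ℝ × ℝ → ℝ≥0)
    (L : ℝ) (hL : 0 < L) :
    ∃ c : ℝ × ℝ, (P.filter (fun p => p ∈ Q c L)).Nonempty ∧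
      ∀ c' : ℝ × ℝ,
        ∑ p ∈ P.filter (fun p => p ∈ Q c' L), w' p ≤
          ∑ p ∈ P.filter (fun p => p ∈ Q c L), w' p := by
  let traces : Set (Finset (ℝ × ℝ)) :=
    {S | S.Nonempty ∧ ∃ c, P.filter (fun p => p ∈ Q c L) = S}
  have hfin : traces.Finite := by
    refine P.powerset.finite_toSet.subset ?_
    rintro S ⟨-, c, rfl⟩
    exact Finset.mem_coe.mpr (Finset.mem_powerset.mpr (Finset.filter_subset _ _))
  have hne : traces.Nonempty := by
    obtain ⟨p, hp⟩ := hP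
    exact ⟨_, ⟨p, Finset.mem_filter.mpr ⟨hp, by simp [Q, (half_pos hL).le]⟩⟩, p, rfl⟩
  obtain ⟨S, ⟨hS, c, rfl⟩, hmax⟩ := Set.exists_max_image traces (fun S => ∑ p ∈ S, w' p) hfin hne
  refine ⟨c, hS, fun c' => ?_⟩
  rcases (P.filter (fun p => p ∈ Q c' L)).eq_empty_or_nonempty with h | h
  · simp [h]
  · exact hmax _ ⟨h, c', rfl⟩

theorem max_square_with_points_on_sides
    (P : Finset (ℝ × ℝ)) (hP : P.Nonempty) (w' : ℝ × ℝ → ℝ≥0) (L : ℝ) (hL : 0 < L) :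
    ∃ c : ℝ × ℝ,
      (∀ c' : ℝ × ℝ,
        ∑ p ∈ P.filter (fun p => p ∈ Q c L), w' p ≥
          ∑ p ∈ P.filter (fun p => p ∈ Q c' L), w' p) ∧
      (∃ p ∈ P, p ∈ Q c L ∧ p.2 = c.2 - L / 2) ∧
      (∃ q ∈ P, q ∈ Q c L ∧ q.1 = c.1 - L / 2) := by
  obtain ⟨c₀, hne, hmax⟩ := exists_center_max_weight P hP w' L hL
  obtain ⟨c, hsub, hbottom, hleft⟩ := exists_center_subset_of_nonempty P L c₀ hne
  exact ⟨c, fun c' => (hmax c').trans (Finset.sum_le_sum_of_subset hsub), hbottom, hleft⟩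
end
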